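/- arXiv:2303.17521 — 2 statements merged into one kernel-verified Lean document; each statement's English description precedes it below -/
import Mathlib

section
/- In the i.i.d. setting, assume r := ∫_{Ω̂} (1/β̂(a)) dP̂(a) < 1. Set M = 1 + ∑_{n=1}^∞ ∫_{Ω̂^n} τ_{ω₁…ω_n}(1) / (∏_{i=1}^n β̂(ω_i)) dP̂^n. Then φ is non-increasing on [0,1] with φ(0) = sup_{x∈[0,1]} φ(x) = 1/(1 − r), φ(1) = inf_{x∈[0,1]} φ(x) = lim_{x→1⁻} φ(x) = 1, and ∫_0^1 φ dl = M. Consequently the normalized density ĥ = φ/M satisfies sup_{x∈[0,1]} ĥ(x) = [(1 − r) · M]^{-1} and inf_{x∈[0,1]} ĥ(x) = 1/M. -/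
open MeasureTheory Filter

/-- Apply beta-transformations with slopes `bs = [β(ω₁), …, β(ω_n)]` in order:
`τ_{ω₁…ω_n} = T_{β(ω_n)} ∘ ⋯ ∘ T_{β(ω₁)}`, where `T_α y = Int.fract (α * y)`. -/
noncomputable def tauList (bs : List ℝ) (x : ℝ) : ℝ :=
  bs.foldl (fun y b => Int.fract (b * y)) x

/-- The (unnormalized) stationary density
`φ(x) = 1 + ∑_{n=1}^∞ ∫_{Ω̂^n} (∏ᵢ β̂(ωᵢ))⁻¹ 𝟙_{[0, τ_{ω₁…ω_n}(1)]}(x) dP̂^n`. -/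
noncomputable def phiFun {Ω : Type*} [MeasurableSpace Ω] (P : Measure Ω) (β : Ω → ℝ)
    (x : ℝ) : ℝ :=
  1 + ∑' n : ℕ, ∫ w : Fin (n + 1) → Ω,
      (∏ i, β (w i))⁻¹ *
        Set.indicator (Set.Icc (0:ℝ) (tauList (List.ofFn fun i => β (w i)) 1)) (fun _ => (1:ℝ)) x
      ∂(Measure.pi fun _ => P)

theorem tauList_mem_Ico {l : List ℝ} (hl : l ≠ []) (x : ℝ) : tauList l x ∈ Set.Ico (0 : ℝ) 1 := by
  rcases List.eq_nil_or_concat l with h | ⟨l', b, rfl⟩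
  · exact absurd h hl
  · simp only [tauList, List.concat_eq_append, List.foldl_append, List.foldl_cons, List.foldl_nil]
    exact ⟨Int.fract_nonneg _, Int.fract_lt_one _⟩

theorem measurable_tauList_ofFn {α : Type*} [MeasurableSpace α] (n : ℕ) (b : Fin n → α → ℝ)
    (hb : ∀ i, Measurable (b i)) (x : α → ℝ) (hx : Measurable x) :
    Measurable fun a => tauList (List.ofFn fun i => b i a) (x a) := by
  induction n generalizing x with
  | zero => simpa [tauList] using hx
  | succ n ih =>
    simp only [List.ofFn_succ, tauList, List.foldl_cons]
    exact ih (fun i => b i.succ) (fun i => hb _) _ ((hb 0).mul hx).fract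

/-- The `n`-fold orbit of `1`, as a function of the word. -/
noncomputable def orbitOne {Ω : Type*} (β : Ω → ℝ) (n : ℕ) (w : Fin n → Ω) : ℝ :=
  tauList (List.ofFn fun i => β (w i)) 1

/-- The integrand in the terms of the series defining `phiFun`. -/
noncomputable def phiKernel {Ω : Type*} (β : Ω → ℝ) (n : ℕ) (x : ℝ) (w : Fin n → Ω) : ℝ :=
  (∏ i, β (w i))⁻¹ * Set.indicator (Set.Icc (0 : ℝ) (orbitOne β n w)) (fun _ => (1 : ℝ)) x

section

variable {Ω : Type*} {β : Ω → ℝ}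

theorem orbitOne_mem_Ico (β : Ω → ℝ) (n : ℕ) (w : Fin (n + 1) → Ω) :
    orbitOne β (n + 1) w ∈ Set.Ico (0 : ℝ) 1 :=
  tauList_mem_Ico (by simp) _

theorem phiKernel_nonneg (hβ : ∀ a, 0 < β a) (n : ℕ) (x : ℝ) (w : Fin n → Ω) :
    0 ≤ phiKernel β n x w :=
  mul_nonneg (inv_nonneg.2 (Finset.prod_nonneg fun _ _ => (hβ _).le))
    (Set.indicator_nonneg (fun _ _ => zero_le_one) _)

theorem phiKernel_le (hβ : ∀ a, 0 < β a) (n : ℕ) (x : ℝ) (w : Fin n → Ω) :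
    phiKernel β n x w ≤ ∏ i, (β (w i))⁻¹ := by
  rw [Finset.prod_inv_distrib]
  exact mul_le_of_le_one_right (inv_nonneg.2 (Finset.prod_nonneg fun _ _ => (hβ _).le))
    (Set.indicator_apply_le' (fun _ => le_rfl) fun _ => zero_le_one)

theorem norm_phiKernel_le (hβ : ∀ a, 0 < β a) (n : ℕ) (x : ℝ) (w : Fin n → Ω) :
    ‖phiKernel β n x w‖ ≤ ∏ i, (β (w i))⁻¹ := by
  rw [Real.norm_of_nonneg (phiKernel_nonneg hβ n x w)]
  exact phiKernel_le hβ n x w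

theorem phiKernel_antitoneOn (hβ : ∀ a, 0 < β a) (n : ℕ) (w : Fin n → Ω) :
    AntitoneOn (fun x => phiKernel β n x w) (Set.Ici 0) := by
  intro x hx y _ hxy
  refine mul_le_mul_of_nonneg_left ?_ (inv_nonneg.2 (Finset.prod_nonneg fun _ _ => (hβ _).le))
  refine Set.indicator_apply_le' (fun h => ?_) fun _ =>
    Set.indicator_nonneg (fun _ _ => zero_le_one) _
  rw [Set.indicator_of_mem (show x ∈ Set.Icc 0 _ from ⟨hx, hxy.trans h.2⟩)]

theorem phiKernel_zero (β : Ω → ℝ) (n : ℕ) (w : Fin (n + 1) → Ω) :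
    phiKernel β (n + 1) 0 w = ∏ i, (β (w i))⁻¹ := by
  have h : (0 : ℝ) ∈ Set.Icc 0 (orbitOne β (n + 1) w) := ⟨le_rfl, (orbitOne_mem_Ico β n w).1⟩
  rw [phiKernel, Set.indicator_of_mem h, mul_one, Finset.prod_inv_distrib]

theorem phiKernel_eq_zero_of_lt {n : ℕ} {x : ℝ} {w : Fin n → Ω} (h : orbitOne β n w < x) :
    phiKernel β n x w = 0 := by
  rw [phiKernel, Set.indicator_of_notMem fun hx => hx.2.not_gt h, mul_zero]

theorem setIntegral_phiKernel (β : Ω → ℝ) (n : ℕ) (w : Fin (n + 1) → Ω) :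
    ∫ x in Set.Icc (0 : ℝ) 1, phiKernel β (n + 1) x w
      = orbitOne β (n + 1) w / ∏ i, β (w i) := by
  have h := orbitOne_mem_Ico β n w
  simp only [phiKernel]
  rw [integral_const_mul, setIntegral_indicator measurableSet_Icc,
    Set.inter_eq_self_of_subset_right (Set.Icc_subset_Icc_right h.2.le)]
  simp [h.1, div_eq_inv_mul]

variable [MeasurableSpace Ω]

theorem measurable_phiKernel (hβ : Measurable β) (n : ℕ) :
    Measurable fun p : ℝ × (Fin n → Ω) => phiKernel β n p.1 p.2 := by
  have hi : ∀ i : Fin n, Measurable fun p : ℝ × (Fin n → Ω) => β (p.2 i) := fun i => by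
    fun_prop
  have hτ : Measurable fun p : ℝ × (Fin n → Ω) => orbitOne β n p.2 :=
    measurable_tauList_ofFn n _ hi _ measurable_const
  refine (Finset.measurable_prod _ fun i _ => hi i).inv.mul ?_
  have hs : MeasurableSet {p : ℝ × (Fin n → Ω) | p.1 ∈ Set.Icc 0 (orbitOne β n p.2)} :=
    (measurableSet_le measurable_const measurable_fst).inter
      (measurableSet_le measurable_fst hτ)
  exact (measurable_const (a := (1 : ℝ))).indicator hs

variable {P : Measure Ω}

theorem integral_phiKernel_nonneg (hβ : ∀ a, 0 < β a) (n : ℕ) (x : ℝ) :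
    0 ≤ ∫ w, phiKernel β n x w ∂(Measure.pi fun _ => P) :=
  integral_nonneg (phiKernel_nonneg hβ n x)

theorem summable_integral_inv_pow (hβ : ∀ a, 0 < β a) (hr : ∫ a, (β a)⁻¹ ∂P < 1) :
    Summable fun n : ℕ => (∫ a, (β a)⁻¹ ∂P) ^ (n + 1) :=
  (summable_nat_add_iff 1).2 (summable_geometric_of_lt_one
    (integral_nonneg fun a => (inv_pos.2 (hβ a)).le) hr)

theorem phiFun_eq_tsum (P : Measure Ω) (β : Ω → ℝ) (x : ℝ) :
    phiFun P β x = 1 + ∑' n : ℕ, ∫ w, phiKernel β (n + 1) x w ∂(Measure.pi fun _ => P) :=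
  rfl

theorem phiFun_one (P : Measure Ω) (β : Ω → ℝ) : phiFun P β 1 = 1 := by
  have h : ∀ n : ℕ, ∀ w : Fin (n + 1) → Ω, phiKernel β (n + 1) 1 w = 0 := fun n w =>
    phiKernel_eq_zero_of_lt (orbitOne_mem_Ico β n w).2
  simp [phiFun_eq_tsum, h]

variable [IsProbabilityMeasure P]

theorem integrable_prod_inv (hint : Integrable (fun a => (β a)⁻¹) P) (n : ℕ) :
    Integrable (fun w : Fin n → Ω => ∏ i, (β (w i))⁻¹) (Measure.pi fun _ => P) :=
  Integrable.fintype_prod fun _ => hint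

theorem integral_prod_inv (β : Ω → ℝ) (P : Measure Ω) [IsProbabilityMeasure P] (n : ℕ) :
    ∫ w : Fin n → Ω, ∏ i, (β (w i))⁻¹ ∂(Measure.pi fun _ => P) = (∫ a, (β a)⁻¹ ∂P) ^ n := by
  rw [integral_fintype_prod_eq_pow (f := fun a => (β a)⁻¹), Fintype.card_fin]

theorem integrable_phiKernel (hβm : Measurable β) (hβ : ∀ a, 0 < β a)
    (hint : Integrable (fun a => (β a)⁻¹) P) (n : ℕ) (x : ℝ) :
    Integrable (phiKernel β n x) (Measure.pi fun _ => P) :=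
  (integrable_prod_inv hint n).mono'
    ((measurable_phiKernel hβm n).comp measurable_prodMk_left).aestronglyMeasurable
    (Eventually.of_forall (norm_phiKernel_le hβ n x))

theorem integral_phiKernel_le (hβm : Measurable β) (hβ : ∀ a, 0 < β a)
    (hint : Integrable (fun a => (β a)⁻¹) P) (n : ℕ) (x : ℝ) :
    ∫ w, phiKernel β n x w ∂(Measure.pi fun _ => P) ≤ (∫ a, (β a)⁻¹ ∂P) ^ n := by
  rw [← integral_prod_inv]
  exact integral_mono (integrable_phiKernel hβm hβ hint n x) (integrable_prod_inv hint n)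
    (phiKernel_le hβ n x)

theorem summable_integral_phiKernel (hβm : Measurable β) (hβ : ∀ a, 0 < β a)
    (hint : Integrable (fun a => (β a)⁻¹) P) (hr : ∫ a, (β a)⁻¹ ∂P < 1) (x : ℝ) :
    Summable fun n : ℕ => ∫ w, phiKernel β (n + 1) x w ∂(Measure.pi fun _ => P) :=
  (summable_integral_inv_pow hβ hr).of_nonneg_of_le
    (fun n => integral_phiKernel_nonneg hβ (n + 1) x)
    fun n => integral_phiKernel_le hβm hβ hint (n + 1) x

theorem phiFun_antitoneOn (hβm : Measurable β) (hβ : ∀ a, 0 < β a)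
    (hint : Integrable (fun a => (β a)⁻¹) P) (hr : ∫ a, (β a)⁻¹ ∂P < 1) :
    AntitoneOn (phiFun P β) (Set.Ici 0) := by
  intro x hx y hy hxy
  simp only [phiFun_eq_tsum]
  gcongr with n
  · exact summable_integral_phiKernel hβm hβ hint hr y
  · exact summable_integral_phiKernel hβm hβ hint hr x
  · exact integrable_phiKernel hβm hβ hint _ y
  · exact integrable_phiKernel hβm hβ hint _ x
  · exact fun w => phiKernel_antitoneOn hβ _ w hx hy hxy

theorem phiFun_zero (hβ : ∀ a, 0 < β a) (hr : ∫ a, (β a)⁻¹ ∂P < 1) :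
    phiFun P β 0 = 1 / (1 - ∫ a, (β a)⁻¹ ∂P) := by
  have h0 : 0 ≤ ∫ a, (β a)⁻¹ ∂P := integral_nonneg fun a => (inv_pos.2 (hβ a)).le
  have h := (summable_geometric_of_lt_one h0 hr).tsum_eq_zero_add
  rw [tsum_geometric_of_lt_one h0 hr, pow_zero] at h
  simp only [phiFun_eq_tsum, phiKernel_zero, integral_prod_inv, one_div, h]

theorem tendsto_phiFun_one (hβm : Measurable β) (hβ : ∀ a, 0 < β a)
    (hint : Integrable (fun a => (β a)⁻¹) P) (hr : ∫ a, (β a)⁻¹ ∂P < 1) :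
    Tendsto (phiFun P β) (nhdsWithin (1 : ℝ) (Set.Iio 1)) (nhds 1) := by
  have hterm : ∀ n : ℕ, Tendsto (fun x => ∫ w, phiKernel β (n + 1) x w ∂(Measure.pi fun _ => P))
      (nhdsWithin (1 : ℝ) (Set.Iio 1)) (nhds 0) := by
    intro n
    rw [← integral_zero (Fin (n + 1) → Ω) ℝ (μ := Measure.pi fun _ => P)]
    refine tendsto_integral_filter_of_dominated_convergence _
      (Eventually.of_forall fun x => (integrable_phiKernel hβm hβ hint _ x).aestronglyMeasurable)
      (Eventually.of_forall fun x => Eventually.of_forall (norm_phiKernel_le hβ _ x))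
      (integrable_prod_inv hint _) (Eventually.of_forall fun w => ?_)
    refine tendsto_const_nhds.congr' ?_
    filter_upwards [mem_nhdsWithin_of_mem_nhds
      (lt_mem_nhds (orbitOne_mem_Ico β n w).2)] with x hx
    exact (phiKernel_eq_zero_of_lt hx).symm
  have h := tendsto_tsum_of_dominated_convergence (summable_integral_inv_pow hβ hr) hterm
    (Eventually.of_forall fun x n => by
      rw [Real.norm_of_nonneg (integral_phiKernel_nonneg hβ _ x)]
      exact integral_phiKernel_le hβm hβ hint _ x)
  rw [funext (phiFun_eq_tsum P β)]
  simpa using h.const_add 1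

theorem integrable_prod_phiKernel (hβm : Measurable β) (hβ : ∀ a, 0 < β a)
    (hint : Integrable (fun a => (β a)⁻¹) P) (n : ℕ) :
    Integrable (fun p : ℝ × (Fin n → Ω) => phiKernel β n p.1 p.2)
      ((volume.restrict (Set.Icc (0 : ℝ) 1)).prod (Measure.pi fun _ => P)) :=
  ((integrable_prod_inv hint n).comp_snd _).mono'
    (measurable_phiKernel hβm n).aestronglyMeasurable
    (Eventually.of_forall fun p => norm_phiKernel_le hβ n p.1 p.2)

theorem setIntegral_phiFun (hβm : Measurable β) (hβ : ∀ a, 0 < β a)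
    (hint : Integrable (fun a => (β a)⁻¹) P) (hr : ∫ a, (β a)⁻¹ ∂P < 1) :
    ∫ x in Set.Icc (0 : ℝ) 1, phiFun P β x
      = 1 + ∑' n : ℕ, ∫ w : Fin (n + 1) → Ω, orbitOne β (n + 1) w / ∏ i, β (w i)
          ∂(Measure.pi fun _ => P) := by
  have hI : ∀ n : ℕ, Integrable (fun x => ∫ w, phiKernel β n x w ∂(Measure.pi fun _ => P))
      (volume.restrict (Set.Icc (0 : ℝ) 1)) := fun n =>
    (integrable_prod_phiKernel hβm hβ hint n).integral_prod_left
  have hS : Summable fun n : ℕ => ∫ x in Set.Icc (0 : ℝ) 1,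
      ‖∫ w, phiKernel β (n + 1) x w ∂(Measure.pi fun _ => P)‖ := by
    refine (summable_integral_inv_pow hβ hr).of_nonneg_of_le
      (fun n => integral_nonneg fun x => norm_nonneg _) fun n => ?_
    refine (integral_mono (hI (n + 1)).norm (integrable_const ((∫ a, (β a)⁻¹ ∂P) ^ (n + 1)))
      fun x => ?_).trans_eq (by simp)
    rw [Real.norm_of_nonneg (integral_phiKernel_nonneg hβ _ x)]
    exact integral_phiKernel_le hβm hβ hint _ x
  have hφ : IntegrableOn (phiFun P β) (Set.Icc 0 1) :=
    ((phiFun_antitoneOn hβm hβ hint hr).mono Set.Icc_subset_Ici_self).integrableOn_isCompact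
      isCompact_Icc
  have hsum : ∫ x in Set.Icc (0 : ℝ) 1, (phiFun P β x - 1)
      = ∑' n : ℕ, ∫ x in Set.Icc (0 : ℝ) 1, ∫ w, phiKernel β (n + 1) x w
          ∂(Measure.pi fun _ => P) := by
    simp only [phiFun_eq_tsum, add_sub_cancel_left]
    exact (integral_tsum_of_summable_integral_norm (fun n => hI (n + 1)) hS).symm
  rw [integral_sub hφ (integrable_const 1)] at hsum
  have hswap : ∀ n : ℕ, ∫ x in Set.Icc (0 : ℝ) 1, ∫ w, phiKernel β (n + 1) x w
      ∂(Measure.pi fun _ => P)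
      = ∫ w : Fin (n + 1) → Ω, orbitOne β (n + 1) w / ∏ i, β (w i) ∂(Measure.pi fun _ => P) := by
    intro n
    rw [integral_integral_swap (integrable_prod_phiKernel hβm hβ hint (n + 1))]
    simp only [setIntegral_phiKernel]
  simp only [hswap] at hsum
  rw [← hsum]
  simp

end

/-- With `r = ∫ 1/β̂ dP̂ < 1` and
`M = 1 + ∑_{n=1}^∞ ∫_{Ω̂^n} τ_{ω₁…ω_n}(1) / ∏ᵢ β̂(ωᵢ) dP̂^n`: `φ` is non-increasing on `[0,1]`,
`φ(0) = sup_{[0,1]} φ = 1/(1-r)`, `φ(1) = inf_{[0,1]} φ = lim_{x→1⁻} φ(x) = 1`,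
`∫_0^1 φ = M`; hence `ĥ = φ/M` has supremum `((1-r)M)⁻¹` and infimum `1/M` on `[0,1]`. -/
theorem stmt_6 {Ω : Type*} [MeasurableSpace Ω] (P : Measure Ω) [IsProbabilityMeasure P]
    (β : Ω → ℝ) (hβmeas : Measurable β) (hβpos : ∀ a, 0 < β a)
    (hint : Integrable (fun a => (β a)⁻¹) P)
    (r : ℝ) (hr : r = ∫ a, (β a)⁻¹ ∂P) (hr1 : r < 1)
    (M : ℝ)
    (hM : M = 1 + ∑' n : ℕ, ∫ w : Fin (n + 1) → Ω,
        tauList (List.ofFn fun i => β (w i)) 1 / ∏ i, β (w i) ∂(Measure.pi fun _ => P)) :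
    (∀ x ∈ Set.Icc (0:ℝ) 1, ∀ y ∈ Set.Icc (0:ℝ) 1, x ≤ y → phiFun P β y ≤ phiFun P β x) ∧
    phiFun P β 0 = 1 / (1 - r) ∧
    IsGreatest (phiFun P β '' Set.Icc (0:ℝ) 1) (phiFun P β 0) ∧
    phiFun P β 1 = 1 ∧
    IsLeast (phiFun P β '' Set.Icc (0:ℝ) 1) (phiFun P β 1) ∧
    Tendsto (phiFun P β) (nhdsWithin (1:ℝ) (Set.Iio 1)) (nhds 1) ∧
    (∫ x in Set.Icc (0:ℝ) 1, phiFun P β x) = M ∧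
    IsGreatest ((fun x => phiFun P β x / M) '' Set.Icc (0:ℝ) 1) (((1 - r) * M)⁻¹) ∧
    IsLeast ((fun x => phiFun P β x / M) '' Set.Icc (0:ℝ) 1) (1 / M) := by
  have hr1' : ∫ a, (β a)⁻¹ ∂P < 1 := hr ▸ hr1
  have hanti := (phiFun_antitoneOn hβmeas hβpos hint hr1').mono
    (Set.Icc_subset_Ici_self (a := (1 : ℝ)) (b := 0))
  have h0 : phiFun P β 0 = 1 / (1 - r) := hr ▸ phiFun_zero hβpos hr1'
  have h1 := phiFun_one P β
  have hmem0 : (0 : ℝ) ∈ Set.Icc (0 : ℝ) 1 := Set.left_mem_Icc.2 zero_le_one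
  have hmem1 : (1 : ℝ) ∈ Set.Icc (0 : ℝ) 1 := Set.right_mem_Icc.2 zero_le_one
  have hM0 : 0 ≤ M := by
    rw [hM]
    refine add_nonneg zero_le_one (tsum_nonneg fun n => integral_nonneg fun w => ?_)
    exact div_nonneg (orbitOne_mem_Ico β n w).1 (Finset.prod_nonneg fun _ _ => (hβpos _).le)
  refine ⟨fun x hx y hy hxy => hanti hx hy hxy, h0,
    hanti.map_isLeast ⟨hmem0, fun x hx => hx.1⟩, h1,
    hanti.map_isGreatest ⟨hmem1, fun x hx => hx.2⟩,
    tendsto_phiFun_one hβmeas hβpos hint hr1',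
    (setIntegral_phiFun hβmeas hβpos hint hr1').trans hM.symm, ?_, ?_⟩
  · refine ⟨⟨0, hmem0, ?_⟩, ?_⟩
    · simp only [h0, mul_inv, div_eq_mul_inv, one_mul]
    · rintro _ ⟨x, hx, rfl⟩
      rw [mul_inv, ← one_div, ← h0, ← div_eq_mul_inv]
      exact div_le_div_of_nonneg_right (hanti hmem0 hx hx.1) hM0
  · refine ⟨⟨1, hmem1, by simp only [h1]⟩, ?_⟩
    rintro _ ⟨x, hx, rfl⟩
    rw [← h1]
    exact div_le_div_of_nonneg_right (hanti hx hmem1 hx.2) hM0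
end

section
/- Let 0 < β₀ ≤ β₁ with β₁ > 1, and let p_c be as defined. For each fixed x ∈ [0,1], the function p ↦ φ(p)(x) is real-analytic on (p_c, 1), and for every p ∈ (p_c,1) its derivative equals ∑_{n=1}^∞ ∑_{w ∈ {0,1}^n, w ∉ {0^n,1^n}} p^{k(w)−1}(1−p)^{n−k(w)−1}(k(w) − np) · 𝟙_{[0,τ_w(1)]}(x)/β_w + ∑_{n=1}^∞ n p^{n−1} 𝟙_{[0,T_{β₁}^n(1)]}(x)/β₁^n − ∑_{n=1}^∞ n (1−p)^{n−1} 𝟙_{[0,T_{β₀}^n(1)]}(x)/β₀^n, these series converging absolutely. -/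
/-- The beta-transformation `T_α(x) = αx - ⌊αx⌋`. -/
noncomputable def betaT (α : ℝ) : ℝ → ℝ := fun x => Int.fract (α * x)

/-- `τ_w` for a word `w ∈ {0,1}^n`: apply `T_{β_{w₁}}` first, …, `T_{β_{w_n}}` last, with
`β_{w_i} = β₁` if `w_i = 1` and `β₀` otherwise. -/
noncomputable def tauWord {n : ℕ} (β₀ β₁ : ℝ) (w : Fin n → Bool) (x : ℝ) : ℝ :=
  (List.ofFn fun i => if w i then β₁ else β₀).foldl (fun y b => Int.fract (b * y)) x

/-- `k(w) = ∑ᵢ wᵢ`, the number of ones in the word `w`. -/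
def kWord {n : ℕ} (w : Fin n → Bool) : ℕ := (Finset.univ.filter fun i => w i = true).card

/-- `β_w = β₁^{k(w)} β₀^{n - k(w)}`. -/
noncomputable def betaWord {n : ℕ} (β₀ β₁ : ℝ) (w : Fin n → Bool) : ℝ :=
  β₁ ^ kWord w * β₀ ^ (n - kWord w)

/-- The weight `a` to the number of ones times `b` to the number of zeros sums to `(a + b) ^ n`. -/
theorem sum_pow_kWord (n : ℕ) (a b : ℝ) :
    ∑ w : Fin n → Bool, a ^ kWord w * b ^ (n - kWord w) = (a + b) ^ n := by
  have h := Fintype.sum_pow (fun c : Bool => if c then a else b) n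
  rw [Fintype.sum_bool] at h
  simp only [if_true, Bool.false_eq_true, if_false] at h
  rw [h]
  refine Finset.sum_congr rfl fun w _ => ?_
  rw [Finset.prod_ite, Finset.prod_const, Finset.prod_const]
  congr 2
  have h2 := Finset.card_filter_add_card_filter_not (s := Finset.univ) (fun i => w i = true)
  rw [Finset.card_univ, Fintype.card_fin] at h2
  unfold kWord
  omega

theorem kWord_true (n : ℕ) : kWord (fun _ : Fin n => true) = n := by simp [kWord]

theorem kWord_false (n : ℕ) : kWord (fun _ : Fin n => false) = 0 := by simp [kWord]

theorem kWord_pos {n : ℕ} {w : Fin n → Bool} (hw : w ≠ fun _ => false) : 0 < kWord w := by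
  obtain ⟨i, hi⟩ := Function.ne_iff.mp hw
  exact Finset.card_pos.mpr ⟨i, by simpa using hi⟩

theorem kWord_lt {n : ℕ} {w : Fin n → Bool} (hw : w ≠ fun _ => true) : kWord w < n := by
  obtain ⟨i, hi⟩ := Function.ne_iff.mp hw
  have := Finset.card_lt_univ_of_notMem
    (s := Finset.univ.filter fun i => w i = true) (x := i) (by simpa using hi)
  simpa [kWord] using this

theorem foldl_replicate_fract (b : ℝ) (n : ℕ) (x : ℝ) :
    (List.replicate n b).foldl (fun y b => Int.fract (b * y)) x = (betaT b)^[n] x := by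
  induction n generalizing x with
  | zero => rfl
  | succ n ih => rw [List.replicate_succ, List.foldl_cons, ih, Function.iterate_succ_apply]; rfl

theorem tauWord_true (β₀ β₁ : ℝ) (n : ℕ) (x : ℝ) :
    tauWord β₀ β₁ (fun _ : Fin n => true) x = (betaT β₁)^[n] x := by
  simp [tauWord, List.ofFn_const, foldl_replicate_fract]

theorem tauWord_false (β₀ β₁ : ℝ) (n : ℕ) (x : ℝ) :
    tauWord β₀ β₁ (fun _ : Fin n => false) x = (betaT β₀)^[n] x := by
  simp [tauWord, List.ofFn_const, foldl_replicate_fract]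

theorem sum_words_split (n : ℕ) (g : (Fin (n + 1) → Bool) → ℝ) :
    ∑ w, g w = ∑ w ∈ (Finset.univ.filter fun w : Fin (n + 1) → Bool =>
        w ≠ (fun _ => true) ∧ w ≠ (fun _ => false)), g w
      + g (fun _ => true) + g (fun _ => false) := by
  rw [← Finset.sum_filter_add_sum_filter_not Finset.univ (fun w : Fin (n + 1) → Bool =>
        w ≠ (fun _ => true) ∧ w ≠ (fun _ => false)), add_assoc]
  congr 1
  have hne : (fun _ : Fin (n + 1) => true) ≠ (fun _ => false) :=
    fun h => by simpa using congrFun h 0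
  rw [← Finset.sum_pair hne]
  refine Finset.sum_congr ?_ fun _ _ => rfl
  ext w
  simp only [Finset.mem_filter, Finset.mem_univ, true_and, Finset.mem_insert,
    Finset.mem_singleton]
  tauto

theorem hasDerivAt_weight (β₀ β₁ c z : ℂ) (k l : ℕ) :
    HasDerivAt (fun z : ℂ => (z / β₁) ^ k * ((1 - z) / β₀) ^ l * c)
      ((k * z ^ (k - 1) * (1 - z) ^ l - l * z ^ k * (1 - z) ^ (l - 1)) * c / (β₁ ^ k * β₀ ^ l))
      z := by
  have h1 := (hasDerivAt_id z).fun_pow k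
  have h2 := ((hasDerivAt_id z).const_sub 1).fun_pow l
  have h3 := ((h1.fun_mul h2).mul_const c).div_const (β₁ ^ k * β₀ ^ l)
  refine (h3.congr_deriv ?_).congr_of_eventuallyEq (.of_eq ?_)
  · simp only [id]
    ring
  · ext y
    simp only [id, div_pow]
    ring

section WeightedSeries

variable {β₀ β₁ : ℝ} (c : ∀ n : ℕ, (Fin (n + 1) → Bool) → ℝ)

/-- The derivative of the degree `n + 1` part of the weighted word series. -/
noncomputable def weightDeriv (β₀ β₁ : ℝ) (n : ℕ) (p : ℝ) : ℝ :=
  ∑ w : Fin (n + 1) → Bool,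
    ((kWord w : ℝ) * p ^ (kWord w - 1) * (1 - p) ^ (n + 1 - kWord w)
      - ((n + 1 - kWord w : ℕ) : ℝ) * p ^ kWord w * (1 - p) ^ (n + 1 - kWord w - 1))
      * c n w / betaWord β₀ β₁ w

theorem analyticAt_and_hasDerivAt_weighted_series (h0 : 0 < β₀) (h1 : 0 < β₁)
    (hc : ∀ n w, |c n w| ≤ 1) {p : ℝ} (hp0 : 0 ≤ p) (hp1 : p ≤ 1)
    (hp : p / β₁ + (1 - p) / β₀ < 1) :
    AnalyticAt ℝ (fun p : ℝ => ∑' n : ℕ, ∑ w : Fin (n + 1) → Bool,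
        (p / β₁) ^ kWord w * ((1 - p) / β₀) ^ (n + 1 - kWord w) * c n w) p ∧
      HasDerivAt (fun p : ℝ => ∑' n : ℕ, ∑ w : Fin (n + 1) → Bool,
        (p / β₁) ^ kWord w * ((1 - p) / β₀) ^ (n + 1 - kWord w) * c n w)
        (∑' n, weightDeriv c β₀ β₁ n p) p := by
  obtain ⟨r, hr, hr1⟩ := exists_between hp
  have hr0 : 0 ≤ r := le_trans (by have := sub_nonneg.mpr hp1; positivity) hr.le
  set f : ℕ → ℂ → ℂ := fun n z => ∑ w : Fin (n + 1) → Bool,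
    (z / β₁) ^ kWord w * ((1 - z) / β₀) ^ (n + 1 - kWord w) * c n w with hf
  set U : Set ℂ := {z | ‖z‖ / β₁ + ‖1 - z‖ / β₀ < r} with hU
  have hUo : IsOpen U := isOpen_lt (by fun_prop) continuous_const
  have hpU : (p : ℂ) ∈ U := by
    have e : (1 - p : ℂ) = ((1 - p : ℝ) : ℂ) := by push_cast; rfl
    simp only [hU, Set.mem_ofPred_eq, e, Complex.norm_real, Real.norm_eq_abs,
      abs_of_nonneg hp0, abs_of_nonneg (sub_nonneg.mpr hp1)]
    exact hr
  have hder : ∀ n z, HasDerivAt (f n) (∑ w : Fin (n + 1) → Bool,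
      ((kWord w : ℂ) * z ^ (kWord w - 1) * (1 - z) ^ (n + 1 - kWord w)
      - ((n + 1 - kWord w : ℕ) : ℂ) * z ^ kWord w * (1 - z) ^ (n + 1 - kWord w - 1))
      * c n w / (β₁ ^ kWord w * β₀ ^ (n + 1 - kWord w))) z := fun n z =>
    HasDerivAt.fun_sum fun w _ => hasDerivAt_weight _ _ _ z _ _
  have hdiff : ∀ n, DifferentiableOn ℂ (f n) U := fun n z _ =>
    (hder n z).differentiableAt.differentiableWithinAt
  have hbound : ∀ n, ∀ z ∈ U, ‖f n z‖ ≤ r ^ (n + 1) := fun n z hz => by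
    calc ‖f n z‖ ≤ ∑ w : Fin (n + 1) → Bool,
          (‖z‖ / β₁) ^ kWord w * (‖1 - z‖ / β₀) ^ (n + 1 - kWord w) := by
          refine norm_sum_le_of_le _ fun w _ => ?_
          simp only [norm_mul, norm_pow, norm_div, Complex.norm_real, Real.norm_eq_abs,
            abs_of_pos h0, abs_of_pos h1]
          exact mul_le_of_le_one_right (by positivity) (hc n w)
      _ = (‖z‖ / β₁ + ‖1 - z‖ / β₀) ^ (n + 1) := sum_pow_kWord _ _ _
      _ ≤ r ^ (n + 1) := pow_le_pow_left₀ (by positivity) (le_of_lt hz) _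
  have hsum : Summable fun n : ℕ => r ^ (n + 1) :=
    (summable_nat_add_iff 1).mpr (summable_geometric_of_lt_one hr0 hr1)
  have hF := Complex.differentiableOn_tsum_of_summable_norm hsum hdiff hUo hbound
  have hD := (Complex.hasSum_deriv_of_summable_norm hsum hdiff hUo hbound hpU).tsum_eq
  have hFan := hF.analyticAt (hUo.mem_nhds hpU)
  have hre : (fun q : ℝ => ∑' n : ℕ, ∑ w : Fin (n + 1) → Bool,
      (q / β₁) ^ kWord w * ((1 - q) / β₀) ^ (n + 1 - kWord w) * c n w) =
      fun q : ℝ => (∑' n, f n (q : ℂ)).re := by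
    ext q
    have e : ∑' n, f n (q : ℂ) = ((∑' n : ℕ, ∑ w : Fin (n + 1) → Bool,
      (q / β₁) ^ kWord w * ((1 - q) / β₀) ^ (n + 1 - kWord w) * c n w : ℝ) : ℂ) := by
      rw [Complex.ofReal_tsum]
      refine tsum_congr fun n => ?_
      simp only [hf]
      push_cast
      rfl
    rw [e, Complex.ofReal_re]
  have hDre : ∑' n, weightDeriv c β₀ β₁ n p = (deriv (fun z => ∑' n, f n z) (p : ℂ)).re := by
    have e : ∑' n, deriv (f n) (p : ℂ) = ((∑' n, weightDeriv c β₀ β₁ n p : ℝ) : ℂ) := by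
      rw [Complex.ofReal_tsum]
      refine tsum_congr fun n => ?_
      rw [(hder n p).deriv, weightDeriv]
      simp only [betaWord]
      push_cast
      rfl
    rw [← hD, e, Complex.ofReal_re]
  rw [hre, hDre]
  exact ⟨hFan.re_ofReal, hFan.differentiableAt.hasDerivAt.real_of_complex⟩

/-- On a nonconstant word the derivative of the weight has a common factor. -/
theorem weight_deriv_factor {k m : ℕ} (hk : 0 < k) (hkm : k < m) (p : ℝ) :
    (k : ℝ) * p ^ (k - 1) * (1 - p) ^ (m - k)
      - ((m - k : ℕ) : ℝ) * p ^ k * (1 - p) ^ (m - k - 1)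
      = p ^ (k - 1) * (1 - p) ^ (m - k - 1) * ((k : ℝ) - m * p) := by
  obtain ⟨i, rfl⟩ := Nat.exists_eq_add_of_lt hk
  obtain ⟨j, rfl⟩ := Nat.exists_eq_add_of_lt hkm
  have e : 0 + i + 1 + j + 1 - (0 + i + 1) = j + 1 := by omega
  rw [e]
  simp only [Nat.add_sub_cancel, zero_add]
  push_cast
  ring

theorem weightDeriv_eq (n : ℕ) (p : ℝ) :
    weightDeriv c β₀ β₁ n p =
      ∑ w ∈ (Finset.univ.filter fun w : Fin (n + 1) → Bool =>
          w ≠ (fun _ => true) ∧ w ≠ (fun _ => false)),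
        p ^ (kWord w - 1) * (1 - p) ^ (n + 1 - kWord w - 1)
          * ((kWord w : ℝ) - (n + 1) * p) * c n w / betaWord β₀ β₁ w
      + ((n : ℝ) + 1) * p ^ n * c n (fun _ => true) / β₁ ^ (n + 1)
      - ((n : ℝ) + 1) * (1 - p) ^ n * c n (fun _ => false) / β₀ ^ (n + 1) := by
  rw [weightDeriv, sum_words_split, sub_eq_add_neg (_ + _)]
  congr 1
  · congr 1
    · refine Finset.sum_congr rfl fun w hw => ?_
      obtain ⟨-, hw1, hw0⟩ := Finset.mem_filter.mp hw
      rw [weight_deriv_factor (kWord_pos hw0) (kWord_lt hw1)]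
      push_cast
      rfl
    · simp [betaWord, kWord_true]
  · simp [betaWord, kWord_false]
    ring

theorem summable_succ_mul_pow {r : ℝ} (hr0 : 0 ≤ r) (hr1 : r < 1) :
    Summable fun n : ℕ => ((n : ℝ) + 1) * r ^ (n + 1) := by
  have h := summable_pow_mul_geometric_of_norm_lt_one (R := ℝ) 1
    (by rwa [Real.norm_eq_abs, abs_of_nonneg hr0] : ‖r‖ < 1)
  simpa using (summable_nat_add_iff 1).mpr h

theorem summable_abs_succ_mul_pow {q β : ℝ} (hq : 0 < q) (hβ : 0 < β) (h : q / β < 1)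
    {d : ℕ → ℝ} (hd : ∀ n, |d n| ≤ 1) :
    Summable fun n : ℕ => |((n : ℝ) + 1) * q ^ n * d n / β ^ (n + 1)| := by
  refine Summable.of_nonneg_of_le (fun _ => abs_nonneg _) (fun n => ?_)
    ((summable_succ_mul_pow (by positivity) h).mul_right q⁻¹)
  have e : |((n : ℝ) + 1) * q ^ n * d n / β ^ (n + 1)|
      = ((n : ℝ) + 1) * (q / β) ^ (n + 1) * q⁻¹ * |d n| := by
    rw [abs_div, abs_mul, abs_of_pos (by positivity : 0 < ((n : ℝ) + 1) * q ^ n),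
      abs_of_pos (by positivity : 0 < β ^ (n + 1)), div_pow, pow_succ q]
    field_simp
  rw [e]
  exact mul_le_of_le_one_right (by positivity) (hd n)

theorem summable_abs_nonconstant_words (h0 : 0 < β₀) (h1 : 0 < β₁)
    (hc : ∀ n w, |c n w| ≤ 1) {p : ℝ} (hp0 : 0 < p) (hp1 : p < 1)
    (hp : p / β₁ + (1 - p) / β₀ < 1) :
    Summable fun n : ℕ => ∑ w ∈ (Finset.univ.filter fun w : Fin (n + 1) → Bool =>
        w ≠ (fun _ => true) ∧ w ≠ (fun _ => false)),
      |p ^ (kWord w - 1) * (1 - p) ^ (n + 1 - kWord w - 1)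
        * ((kWord w : ℝ) - (n + 1) * p) * c n w / betaWord β₀ β₁ w| := by
  have hq : 0 < 1 - p := sub_pos.mpr hp1
  refine Summable.of_nonneg_of_le (fun _ => Finset.sum_nonneg fun _ _ => abs_nonneg _)
    (fun n => ?_)
    ((summable_succ_mul_pow (by positivity) hp).mul_right (p * (1 - p))⁻¹)
  calc _ ≤ ∑ w ∈ (Finset.univ.filter fun w : Fin (n + 1) → Bool =>
          w ≠ (fun _ => true) ∧ w ≠ (fun _ => false)),
        ((n : ℝ) + 1) * (p * (1 - p))⁻¹ *
          ((p / β₁) ^ kWord w * ((1 - p) / β₀) ^ (n + 1 - kWord w)) := by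
        refine Finset.sum_le_sum fun w hw => ?_
        obtain ⟨-, hw1, hw0⟩ := Finset.mem_filter.mp hw
        have hk := kWord_pos hw0
        have hkn := kWord_lt hw1
        have hkn' : (kWord w : ℝ) ≤ n + 1 := by exact_mod_cast hkn.le
        have hl : |(kWord w : ℝ) - (n + 1) * p| ≤ n + 1 := by
          have hk0 : (0 : ℝ) ≤ kWord w := Nat.cast_nonneg _
          have hn0 : (0 : ℝ) ≤ n := Nat.cast_nonneg _
          rw [abs_le]
          constructor <;> nlinarith
        have e1 : p ^ kWord w = p ^ (kWord w - 1) * p := by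
          rw [← pow_succ, Nat.sub_add_cancel hk]
        have e2 : (1 - p) ^ (n + 1 - kWord w) = (1 - p) ^ (n + 1 - kWord w - 1) * (1 - p) := by
          rw [← pow_succ, Nat.sub_add_cancel (by omega)]
        have hB : 0 < betaWord β₀ β₁ w := by unfold betaWord; positivity
        have e3 : (p / β₁) ^ kWord w * ((1 - p) / β₀) ^ (n + 1 - kWord w)
            = p ^ (kWord w - 1) * (1 - p) ^ (n + 1 - kWord w - 1) * (p * (1 - p))
              / betaWord β₀ β₁ w := by
          rw [div_pow, div_pow, e1, e2, betaWord]
          field_simp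
        rw [e3, abs_div, abs_mul, abs_mul, abs_of_pos hB, abs_of_pos (by positivity :
          0 < p ^ (kWord w - 1) * (1 - p) ^ (n + 1 - kWord w - 1))]
        have e4 : ((n : ℝ) + 1) * (p * (1 - p))⁻¹ *
            (p ^ (kWord w - 1) * (1 - p) ^ (n + 1 - kWord w - 1) * (p * (1 - p))
              / betaWord β₀ β₁ w)
            = p ^ (kWord w - 1) * (1 - p) ^ (n + 1 - kWord w - 1) * (n + 1) * 1
              / betaWord β₀ β₁ w := by
          field_simp
        rw [e4]
        gcongr
        exact hc n w
    _ ≤ ∑ w : Fin (n + 1) → Bool, ((n : ℝ) + 1) * (p * (1 - p))⁻¹ *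
          ((p / β₁) ^ kWord w * ((1 - p) / β₀) ^ (n + 1 - kWord w)) :=
        Finset.sum_le_sum_of_subset_of_nonneg (Finset.filter_subset _ _)
          fun _ _ _ => by positivity
    _ = ((n : ℝ) + 1) * (p / β₁ + (1 - p) / β₀) ^ (n + 1) * (p * (1 - p))⁻¹ := by
        rw [← Finset.mul_sum, sum_pow_kWord]
        ring

end WeightedSeries

/-- Above the critical parameter the two branch weights sum to less than one. -/
theorem pos_and_weight_sum_lt_one {β₀ β₁ pc p : ℝ} (h0 : 0 < β₀) (h1 : 1 < β₁)
    (hpc0 : 1 ≤ β₀ → pc = 0)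
    (hpc1 : β₀ < 1 → pc ∈ Set.Ioo (0:ℝ) 1 ∧ pc / β₁ + (1 - pc) / β₀ = 1)
    (hp : p ∈ Set.Ioo pc 1) : 0 < p ∧ p / β₁ + (1 - p) / β₀ < 1 := by
  obtain ⟨hp, hp1⟩ := hp
  have hβ₁ : 0 < β₁ := zero_lt_one.trans h1
  rcases le_or_gt 1 β₀ with h | h
  · obtain rfl := hpc0 h
    refine ⟨hp, ?_⟩
    have e1 : p / β₁ < p := div_lt_self hp h1
    have e2 : (1 - p) / β₀ ≤ 1 - p := div_le_self (sub_nonneg.mpr hp1.le) h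
    linarith
  · obtain ⟨⟨hpc, -⟩, he⟩ := hpc1 h
    refine ⟨hpc.trans hp, ?_⟩
    have hlt : (p - pc) / β₁ < (p - pc) / β₀ :=
      div_lt_div_of_pos_left (sub_pos.mpr hp) h0 (h.trans h1)
    have e : p / β₁ + (1 - p) / β₀
        = pc / β₁ + (1 - pc) / β₀ + ((p - pc) / β₁ - (p - pc) / β₀) := by ring
    linarith

/-- For `0 < β₀ ≤ β₁`, `β₁ > 1`, `p_c` as defined and fixed `x ∈ [0,1]`,
the map `p ↦ φ(p)(x)` is real-analytic on `(p_c, 1)` and its derivative is the stated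
explicit series, the three series converging absolutely. -/
theorem stmt_10 (β₀ β₁ : ℝ) (h0 : 0 < β₀) (h01 : β₀ ≤ β₁) (h1 : 1 < β₁)
    (pc : ℝ) (hpc0 : 1 ≤ β₀ → pc = 0)
    (hpc1 : β₀ < 1 → pc ∈ Set.Ioo (0:ℝ) 1 ∧ pc / β₁ + (1 - pc) / β₀ = 1)
    (x : ℝ) (hx : x ∈ Set.Icc (0:ℝ) 1) :
    AnalyticOnNhd ℝ
      (fun p : ℝ => 1 + ∑' n : ℕ, ∑ w : Fin (n + 1) → Bool,
        (p / β₁) ^ kWord w * ((1 - p) / β₀) ^ (n + 1 - kWord w) *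
          Set.indicator (Set.Icc (0:ℝ) (tauWord β₀ β₁ w 1)) (fun _ => (1:ℝ)) x)
      (Set.Ioo pc 1) ∧
    ∀ p ∈ Set.Ioo pc 1,
      (HasDerivAt
        (fun p : ℝ => 1 + ∑' n : ℕ, ∑ w : Fin (n + 1) → Bool,
          (p / β₁) ^ kWord w * ((1 - p) / β₀) ^ (n + 1 - kWord w) *
            Set.indicator (Set.Icc (0:ℝ) (tauWord β₀ β₁ w 1)) (fun _ => (1:ℝ)) x)
        ((∑' n : ℕ, ∑ w ∈ (Finset.univ.filter fun w : Fin (n + 1) → Bool =>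
              w ≠ (fun _ => true) ∧ w ≠ (fun _ => false)),
            p ^ (kWord w - 1) * (1 - p) ^ (n + 1 - kWord w - 1)
              * ((kWord w : ℝ) - (n + 1) * p)
              * Set.indicator (Set.Icc (0:ℝ) (tauWord β₀ β₁ w 1)) (fun _ => (1:ℝ)) x
              / betaWord β₀ β₁ w)
          + (∑' n : ℕ, ((n : ℝ) + 1) * p ^ n *
              Set.indicator (Set.Icc (0:ℝ) ((betaT β₁)^[n + 1] 1)) (fun _ => (1:ℝ)) x
              / β₁ ^ (n + 1))
          - (∑' n : ℕ, ((n : ℝ) + 1) * (1 - p) ^ n *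
              Set.indicator (Set.Icc (0:ℝ) ((betaT β₀)^[n + 1] 1)) (fun _ => (1:ℝ)) x
              / β₀ ^ (n + 1)))
        p) ∧
      Summable (fun n : ℕ => ∑ w ∈ (Finset.univ.filter fun w : Fin (n + 1) → Bool =>
            w ≠ (fun _ => true) ∧ w ≠ (fun _ => false)),
          |p ^ (kWord w - 1) * (1 - p) ^ (n + 1 - kWord w - 1)
            * ((kWord w : ℝ) - (n + 1) * p)
            * Set.indicator (Set.Icc (0:ℝ) (tauWord β₀ β₁ w 1)) (fun _ => (1:ℝ)) x
            / betaWord β₀ β₁ w|) ∧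
      Summable (fun n : ℕ => |((n : ℝ) + 1) * p ^ n *
          Set.indicator (Set.Icc (0:ℝ) ((betaT β₁)^[n + 1] 1)) (fun _ => (1:ℝ)) x
          / β₁ ^ (n + 1)|) ∧
      Summable (fun n : ℕ => |((n : ℝ) + 1) * (1 - p) ^ n *
          Set.indicator (Set.Icc (0:ℝ) ((betaT β₀)^[n + 1] 1)) (fun _ => (1:ℝ)) x
          / β₀ ^ (n + 1)|) := by
  have hβ₁ : 0 < β₁ := zero_lt_one.trans h1
  set c : ∀ n : ℕ, (Fin (n + 1) → Bool) → ℝ := fun n w =>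
    Set.indicator (Set.Icc (0:ℝ) (tauWord β₀ β₁ w 1)) (fun _ => (1:ℝ)) x with hc_def
  have hind : ∀ t : ℝ, |Set.indicator (Set.Icc (0:ℝ) t) (fun _ => (1:ℝ)) x| ≤ 1 := fun t => by
    by_cases h : x ∈ Set.Icc (0:ℝ) t <;> simp [h]
  have hc : ∀ n w, |c n w| ≤ 1 := fun n w => hind _
  refine ⟨fun p hp => ?_, fun p hp => ?_⟩
  · obtain ⟨hp0, hlt⟩ := pos_and_weight_sum_lt_one h0 h1 hpc0 hpc1 hp
    exact analyticAt_const.add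
      (analyticAt_and_hasDerivAt_weighted_series c h0 hβ₁ hc hp0.le hp.2.le hlt).1
  · obtain ⟨hp0, hlt⟩ := pos_and_weight_sum_lt_one h0 h1 hpc0 hpc1 hp
    have hq : 0 < 1 - p := sub_pos.mpr hp.2
    have ha : 0 < p / β₁ := by positivity
    have hb : 0 < (1 - p) / β₀ := by positivity
    have hA := summable_abs_nonconstant_words c h0 hβ₁ hc hp0 hp.2 hlt
    have hB := summable_abs_succ_mul_pow hp0 hβ₁ (by linarith)
      (fun n => hind ((betaT β₁)^[n + 1] 1))
    have hC := summable_abs_succ_mul_pow hq h0 (by linarith)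
      (fun n => hind ((betaT β₀)^[n + 1] 1))
    refine ⟨?_, hA, hB, hC⟩
    have hA' := hA
    simp_rw [← Real.norm_eq_abs] at hA'
    replace hA' := hA'.of_norm_bounded fun n => norm_sum_le _ _
    have h := (analyticAt_and_hasDerivAt_weighted_series c h0 hβ₁ hc hp0.le hp.2.le
      hlt).2.const_add 1
    refine h.congr_deriv ?_
    rw [← hA'.tsum_add hB.of_abs, ← (hA'.add hB.of_abs).tsum_sub hC.of_abs]
    refine tsum_congr fun n => ?_
    rw [weightDeriv_eq]
    simp only [hc_def, tauWord_true, tauWord_false]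
end
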